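/- arXiv:2312.01608 — 9 statements merged into one kernel-verified Lean document; each statement's English description precedes it below -/
import Mathlib

section
/- Let n ≥ 1, U = {η ∈ ℝⁿ : ηᵢ > 0 for all i and Σᵢ ηᵢ < 1}, p_{n+1}(η) = 1 − Σᵢ ηᵢ, and let G : U → Matrix (Fin n) (Fin n) ℝ be given by G_{jk}(η) = δ_{jk}/η_j + 1/p_{n+1}(η). Then for every η ∈ U and all indices i, j, k, the Christoffel symbol of the first kind of G satisfies (1/2)(∂_i G_{jk} + ∂_j G_{ik} − ∂_k G_{ij})(η) = −(1/2)( δ_{ij}δ_{jk}/η_i² − 1/p_{n+1}(η)² ). -/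
theorem hasFDerivAt_ite_one_div_apply {n : ℕ} {η : Fin n → ℝ} (h : ∀ i, η i ≠ 0) (j k : Fin n) :
    HasFDerivAt (fun x : Fin n → ℝ => if j = k then 1 / x j else 0)
      (if j = k then (-(η j ^ 2)⁻¹) • ContinuousLinearMap.proj (R := ℝ) (φ := fun _ => ℝ) j
        else 0) η := by
  split_ifs
  · simpa only [one_div, Function.comp_def] using
      (hasDerivAt_inv (h j)).comp_hasFDerivAt η (hasFDerivAt_apply (𝕜 := ℝ) j η)
  · exact hasFDerivAt_const _ _

theorem hasFDerivAt_one_div_one_sub_sum {n : ℕ} {η : Fin n → ℝ} (h : 1 - ∑ i, η i ≠ 0) :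
    HasFDerivAt (fun x : Fin n → ℝ => 1 / (1 - ∑ i, x i))
      (((1 - ∑ i, η i) ^ 2)⁻¹ •
        ∑ i, ContinuousLinearMap.proj (R := ℝ) (φ := fun _ : Fin n => ℝ) i) η := by
  have hsum : HasFDerivAt (fun x : Fin n → ℝ => 1 - ∑ i, x i)
      (-∑ i, ContinuousLinearMap.proj (R := ℝ) (φ := fun _ : Fin n => ℝ) i) η :=
    (HasFDerivAt.fun_sum fun i _ => hasFDerivAt_apply (𝕜 := ℝ) i η).const_sub 1
  simpa only [one_div, Function.comp_def, neg_smul, smul_neg, neg_neg] using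
    (hasDerivAt_inv h).comp_hasFDerivAt η hsum

/-- The partial derivatives of the Fisher matrix of the open simplex. -/
theorem fderiv_fisher_single {n : ℕ} {η : Fin n → ℝ} (h : ∀ i, η i ≠ 0)
    (hp : 1 - ∑ i, η i ≠ 0) (i j k : Fin n) :
    fderiv ℝ (fun x : Fin n → ℝ => (if j = k then 1 / x j else 0) + 1 / (1 - ∑ i, x i)) η
        (Pi.single i 1)
      = -(if i = j ∧ j = k then 1 / η i ^ 2 else 0) + 1 / (1 - ∑ i, η i) ^ 2 := by
  rw [((hasFDerivAt_ite_one_div_apply h j k).fun_add (hasFDerivAt_one_div_one_sub_sum hp)).fderiv]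
  by_cases hjk : j = k <;> by_cases hij : i = j
  · subst hij hjk; simp
  · simp [hjk, Pi.single_apply, hjk ▸ Ne.symm hij, hjk ▸ hij]
  · simp [hjk]
  · simp [hjk]

/-- the Christoffel symbol of the first kind of the Fisher matrix `G` on the
open probability simplex satisfies
`(1/2)(∂_i G_{jk} + ∂_j G_{ik} − ∂_k G_{ij}) = −(1/2)(δ_{ij}δ_{jk}/η_i² − 1/p_{n+1}(η)²)`. -/
theorem stmt_2 (n : ℕ) (hn : 1 ≤ n)
    (U : Set (Fin n → ℝ)) (hU : U = {η | (∀ i, 0 < η i) ∧ ∑ i, η i < 1})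
    (pn1 : (Fin n → ℝ) → ℝ) (hpn1 : ∀ η, pn1 η = 1 - ∑ i, η i)
    (G : (Fin n → ℝ) → Matrix (Fin n) (Fin n) ℝ)
    (hG : ∀ η j k, G η j k = (if j = k then 1 / η j else 0) + 1 / pn1 η)
    (η : Fin n → ℝ) (hη : η ∈ U) (i j k : Fin n) :
    (1 / 2 : ℝ) * (fderiv ℝ (fun x => G x j k) η (Pi.single i 1)
        + fderiv ℝ (fun x => G x i k) η (Pi.single j 1)
        - fderiv ℝ (fun x => G x i j) η (Pi.single k 1))
      = -(1 / 2 : ℝ) * ((if i = j ∧ j = k then 1 / (η i) ^ 2 else 0) - 1 / (pn1 η) ^ 2) := by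
  subst hU
  have h : ∀ i, η i ≠ 0 := fun i => (hη.1 i).ne'
  have hp : 1 - ∑ i, η i ≠ 0 := (sub_pos.mpr hη.2).ne'
  simp only [hG, hpn1, fderiv_fisher_single h hp]
  have h₁ : (j = i ∧ i = k) ↔ (i = j ∧ j = k) := by grind
  have h₂ : (k = i ∧ i = j) ↔ (i = j ∧ j = k) := by grind
  by_cases hijk : i = j ∧ j = k
  · obtain ⟨rfl, rfl⟩ := hijk
    simp only [and_self, if_true]
    ring
  · simp only [h₁, h₂, hijk, if_false]
    ring
end

section
/- Let n ≥ 1 and let p : Fin (n+1) → ℝ satisfy p(ω) > 0 for all ω and Σ_ω p(ω) = 1; write q = p(n+1). Define B ∈ Matrix (Fin n) (Fin n) ℝ by B i j = −p(i)p(j) + (if i = j then p(i) else 0), and T : Fin n → Fin n → Fin n → ℝ by T i j l = −(1/2)( (if i = j ∧ j = l then 1/p(i)² else 0) − 1/q² ). Then for every k ∈ Fin n: Σ_{i,j,l} B i j · B k l · T i j l = (1/2)( (n+1)·p(k) − 1 ). -/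
/-- the `k`-th component of the trace vector field `tr_g K` on the simplex:
`∑_{i,j,l} B i j · B k l · T i j l = (1/2)((n+1) p(k) − 1)`. -/
theorem stmt_3 (n : ℕ) (hn : 1 ≤ n) (p : Fin (n + 1) → ℝ)
    (hpos : ∀ ω, 0 < p ω) (hsum : ∑ ω, p ω = 1)
    (B : Matrix (Fin n) (Fin n) ℝ)
    (hB : ∀ i j, B i j = -(p i.castSucc * p j.castSucc) +
      (if i = j then p i.castSucc else 0))
    (T : Fin n → Fin n → Fin n → ℝ)
    (hT : ∀ i j l, T i j l = -(1 / 2 : ℝ) *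
      ((if i = j ∧ j = l then 1 / (p i.castSucc) ^ 2 else 0) - 1 / (p (Fin.last n)) ^ 2))
    (k : Fin n) :
    ∑ i, ∑ j, ∑ l, B i j * B k l * T i j l
      = (1 / 2 : ℝ) * (((n : ℝ) + 1) * p k.castSucc - 1) := by
  have hq := (hpos (Fin.last n)).ne'
  have hS : ∑ i : Fin n, p i.castSucc = 1 - p (Fin.last n) := by
    rw [Fin.sum_univ_castSucc] at hsum
    linarith
  have hrow (i : Fin n) : ∑ j, B i j = p i.castSucc * p (Fin.last n) := by
    simp only [hB, Finset.sum_add_distrib, Finset.sum_neg_distrib, ← Finset.mul_sum, hS,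
      Finset.sum_ite_eq, Finset.mem_univ, if_true]
    ring
  have hdiag : ∑ i, B i i * B k i * (1 / p i.castSucc ^ 2)
      = 1 - p k.castSucc * (n + p (Fin.last n)) := by
    have hterm (i : Fin n) : B i i * B k i * (1 / p i.castSucc ^ 2)
        = p k.castSucc * p i.castSucc - p k.castSucc
          + (if k = i then 1 - p i.castSucc else 0) := by
      have hi := (hpos i.castSucc).ne'
      rw [hB, hB, if_pos rfl]
      by_cases h : k = i
      · subst h
        simp only [if_true]
        field_simp
        ring
      · simp only [h, if_false]
        field_simp
        ring
    simp only [hterm, Finset.sum_add_distrib, Finset.sum_sub_distrib, ← Finset.mul_sum, hS,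
      Finset.sum_ite_eq, Finset.mem_univ, if_true, Finset.sum_const, Finset.card_univ,
      Fintype.card_fin, nsmul_eq_mul]
    ring
  have hinner (i j : Fin n) : ∑ l, B i j * B k l * T i j l
      = -(1 / 2 : ℝ) * (if i = j then B i i * B k i * (1 / p i.castSucc ^ 2) else 0)
        + 1 / 2 * (p k.castSucc / p (Fin.last n)) * B i j := by
    have hterm (l : Fin n) : B i j * B k l * T i j l
        = (if j = l then -(1 / 2 : ℝ) *
            (if i = j then B i i * B k i * (1 / p i.castSucc ^ 2) else 0) else 0)
          + 1 / 2 * (1 / p (Fin.last n) ^ 2) * B i j * B k l := by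
      rw [hT]
      by_cases hij : i = j
      · subst hij
        by_cases hil : i = l
        · subst hil
          simp only [and_self, if_true]
          ring
        · simp only [hil, and_false, if_false]
          ring
      · simp only [hij, false_and, if_false, mul_zero, ite_self]
        ring
    simp only [hterm, Finset.sum_add_distrib, ← Finset.mul_sum, hrow, Finset.sum_ite_eq,
      Finset.mem_univ, if_true]
    field_simp
  simp only [hinner, Finset.sum_add_distrib, ← Finset.mul_sum, ← Finset.sum_mul, hrow, hS,
    Finset.sum_ite_eq, Finset.mem_univ, if_true, hdiag]
  field_simp
  ring
end

section
/- Let n ≥ 1, U = {η ∈ ℝⁿ : ηᵢ > 0 for all i and Σᵢ ηᵢ < 1}, p_ω(η) = η_ω for ω ≤ n, p_{n+1}(η) = 1 − Σᵢ ηᵢ, and let G : U → Matrix (Fin n) (Fin n) ℝ be the Fisher matrix G_{ij}(η) = δ_{ij}/η_i + 1/p_{n+1}(η). Define X : U → ℝⁿ by Xⁱ(η) = (1/2)((n+1)η_i − 1). Then det G(η) > 0 for all η ∈ U, and for every η ∈ U: Σᵢ ∂_i Xⁱ(η) + (1/2) Σᵢ Xⁱ(η) · ∂_i( ln det G )(η)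 = (1/4)( n² − 1 + Σ_{ω=1}^{n+1} 1/p_ω(η) ). -/
open Matrix in
theorem det_diagonal_inv_add_const {ι : Type*} [Fintype ι] [DecidableEq ι] {x : ι → ℝ}
    (hx : ∀ i, x i ≠ 0) (hq : 1 - ∑ i, x i ≠ 0) :
    (Matrix.of fun i j => (if i = j then 1 / x i else 0) + 1 / (1 - ∑ i, x i)).det
      = (∏ i, (x i)⁻¹) * (1 - ∑ i, x i)⁻¹ := by
  have hfactor : (Matrix.of fun i j => (if i = j then 1 / x i else 0) + 1 / (1 - ∑ i, x i))
      = diagonal (fun i => (x i)⁻¹) * (1 + replicateCol Unit x *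
          replicateRow Unit (fun _ => (1 - ∑ i, x i)⁻¹)) := by
    ext i j
    have hi := hx i
    rw [diagonal_mul]
    by_cases hij : i = j
    · simp [hij, Matrix.mul_apply, mul_add, hx j]
    · simp [hij, Matrix.mul_apply, hi]
  rw [hfactor, det_mul, det_diagonal, det_one_add_replicateCol_mul_replicateRow]
  congr 1
  simp only [dotProduct, ← Finset.mul_sum]
  field_simp
  ring

theorem isOpen_openSimplex {ι : Type*} [Fintype ι] :
    IsOpen {x : ι → ℝ | (∀ i, 0 < x i) ∧ ∑ i, x i < 1} := by
  simp only [Set.ofPred_and, Set.ofPred_forall]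
  exact (isOpen_iInter_of_finite fun i => isOpen_lt continuous_const (continuous_apply i)).inter
    (isOpen_lt (by fun_prop) continuous_const)

theorem hasFDerivAt_neg_sum_log_sub_log {ι : Type*} [Fintype ι] {x : ι → ℝ}
    (hx : ∀ i, x i ≠ 0) (hq : 1 - ∑ i, x i ≠ 0) :
    HasFDerivAt (fun y : ι → ℝ => -(∑ i, Real.log (y i)) - Real.log (1 - ∑ i, y i))
      (-(∑ i, (x i)⁻¹ • ContinuousLinearMap.proj (R := ℝ) (φ := fun _ : ι => ℝ) i)
        - (1 - ∑ i, x i)⁻¹ •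
          -(∑ i, ContinuousLinearMap.proj (R := ℝ) (φ := fun _ : ι => ℝ) i)) x :=
  (HasFDerivAt.fun_sum fun i _ => (hasFDerivAt_apply i x).log (hx i)).fun_neg.fun_sub
    (((HasFDerivAt.fun_sum fun i _ => hasFDerivAt_apply i x).const_sub 1).log hq)

/-- `det G > 0` on the open probability simplex, and the Riemannian divergence of
the trace vector field `X^i(η) = (1/2)((n+1)η_i − 1)` equals
`(1/4)(n² − 1 + ∑_{ω=1}^{n+1} 1/p_ω(η))`. -/
theorem stmt_4 (n : ℕ) (hn : 1 ≤ n)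
    (U : Set (Fin n → ℝ)) (hU : U = {η | (∀ i, 0 < η i) ∧ ∑ i, η i < 1})
    (p : Fin (n + 1) → (Fin n → ℝ) → ℝ)
    (hp : ∀ (ω : Fin (n + 1)) (η : Fin n → ℝ),
      p ω η = if h : (ω : ℕ) < n then η ⟨(ω : ℕ), h⟩ else 1 - ∑ i, η i)
    (G : (Fin n → ℝ) → Matrix (Fin n) (Fin n) ℝ)
    (hG : ∀ η i j, G η i j = (if i = j then 1 / η i else 0) + 1 / p (Fin.last n) η)
    (X : (Fin n → ℝ) → Fin n → ℝ)
    (hX : ∀ η i, X η i = (1 / 2 : ℝ) * (((n : ℝ) + 1) * η i - 1)) :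
    (∀ η ∈ U, 0 < (G η).det) ∧
    (∀ η ∈ U,
      (∑ i, fderiv ℝ (fun x => X x i) η (Pi.single i 1))
        + (1 / 2 : ℝ) * ∑ i, X η i * fderiv ℝ (fun x => Real.log (G x).det) η (Pi.single i 1)
      = (1 / 4 : ℝ) * ((n : ℝ) ^ 2 - 1 + ∑ ω : Fin (n + 1), 1 / p ω η)) := by
  have hlast (η) : p (Fin.last n) η = 1 - ∑ i, η i := by simp [hp]
  have hdet : ∀ η ∈ U, (G η).det = (∏ i, (η i)⁻¹) * (1 - ∑ i, η i)⁻¹ := by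
    rintro η hη
    rw [hU] at hη
    rw [← det_diagonal_inv_add_const (fun i => (hη.1 i).ne') (sub_pos.2 hη.2).ne']
    congr 1
    ext i j
    rw [hG, hlast, Matrix.of_apply]
  refine ⟨fun η hη => ?_, fun η hη => ?_⟩
  · rw [hdet η hη]
    rw [hU] at hη
    exact mul_pos (Finset.prod_pos fun i _ => inv_pos.2 (hη.1 i)) (inv_pos.2 (sub_pos.2 hη.2))
  have hUη : U ∈ nhds η := (hU ▸ isOpen_openSimplex : IsOpen U).mem_nhds hη
  have hlog : (fun x => Real.log (G x).det) =ᶠ[nhds η]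
      fun x => -(∑ i, Real.log (x i)) - Real.log (1 - ∑ i, x i) := by
    filter_upwards [hUη] with x hxU
    rw [hdet x hxU]
    rw [hU] at hxU
    rw [Real.log_mul (Finset.prod_ne_zero_iff.2 fun i _ => inv_ne_zero (hxU.1 i).ne')
      (inv_ne_zero (sub_pos.2 hxU.2).ne'),
      Real.log_prod fun i _ => inv_ne_zero (hxU.1 i).ne']
    simp [Real.log_inv, sub_eq_add_neg]
  rw [hU] at hη
  have hη0 (i) : η i ≠ 0 := (hη.1 i).ne'
  have hq : 1 - ∑ i, η i ≠ 0 := (sub_pos.2 hη.2).ne'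
  have hdlog (i) : fderiv ℝ (fun x => Real.log (G x).det) η (Pi.single i 1)
      = -(η i)⁻¹ + (1 - ∑ i, η i)⁻¹ := by
    rw [hlog.fderiv_eq, (hasFDerivAt_neg_sum_log_sub_log hη0 hq).fderiv]
    simp [Pi.single_apply]
  have hdX (i) : fderiv ℝ (fun x => X x i) η (Pi.single i 1) = (1 / 2 : ℝ) * ((n : ℝ) + 1) := by
    simp only [hX]
    have h := (((hasFDerivAt_apply (𝕜 := ℝ) i η).const_mul ((n : ℝ) + 1)).sub_const 1).const_mul
      (1 / 2 : ℝ)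
    rw [h.fderiv]
    simp
  have hterm (i) : X η i * (-(η i)⁻¹ + (1 - ∑ i, η i)⁻¹)
      = (1 / 2 : ℝ) * ((η i)⁻¹ - ((n : ℝ) + 1)
        + (((n : ℝ) + 1) * η i - 1) * (1 - ∑ i, η i)⁻¹) := by
    rw [hX]
    linear_combination (-(1 / 2 : ℝ) * ((n : ℝ) + 1)) * mul_inv_cancel₀ (hη0 i)
  have hsum : ∑ ω : Fin (n + 1), 1 / p ω η = ∑ i, (η i)⁻¹ + (1 - ∑ i, η i)⁻¹ := by
    rw [Fin.sum_univ_castSucc, hlast]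
    simp [hp]
  simp only [hdX, hdlog, hterm, hsum, ← Finset.mul_sum, ← Finset.sum_mul, Finset.sum_add_distrib,
    Finset.sum_sub_distrib, Finset.sum_const, Finset.card_univ, Fintype.card_fin, nsmul_eq_mul]
  linear_combination (-(1 / 4 : ℝ) * ((n : ℝ) + 1)) * mul_inv_cancel₀ hq
end

section
/- Let U ⊆ ℝ^m be open, G : U → Matrix (Fin m) (Fin m) ℝ C², with G(x) symmetric and invertible for every x. Define the Levi-Civita Christoffel matrices Γ^g : U → Fin m → Matrix (Fin m) (Fin m) ℝ by (Γ^g_k)ⁱⱼ = (1/2) Σ_s (G⁻¹)ⁱˢ( ∂_k G_{sj} + ∂_j G_{sk} − ∂_s G_{kj} ). Let Γ : U → Fin m → Matrix (Fin m) (Fin m) ℝ be C¹, set K_k = Γ_k − Γ^g_k, assume G·K_k is a symmetric matrix at every point for every k, and set Γ̄_k = Γ^g_k − K_k. Define curvature matrices R_{kl} = ∂_kΓ_l − ∂_lΓ_k + Γ_kΓ_l − Γ_lΓ_k, and likewise R̄_{kl} from Γ̄ and R^g_{kl} from Γ^g. Then at every point of U and for all k, l: (1/2)(R_{kl} + R̄_{kl})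 = R^g_{kl} + K_k·K_l − K_l·K_k. -/
open Matrix

/-- Entrywise partial derivative in the `k`-th coordinate direction of a matrix-valued map. -/
noncomputable def pd {m : ℕ} (k : Fin m) (F : (Fin m → ℝ) → Matrix (Fin m) (Fin m) ℝ)
    (x : Fin m → ℝ) : Matrix (Fin m) (Fin m) ℝ :=
  Matrix.of fun i j => fderiv ℝ (fun y => F y i j) x (Pi.single k 1)

theorem differentiableAt_matrix_det {E n : Type*} [NormedAddCommGroup E] [NormedSpace ℝ E]
    [Fintype n] [DecidableEq n] {A : E → Matrix n n ℝ} {x : E}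
    (hA : ∀ i j, DifferentiableAt ℝ (fun y => A y i j) x) :
    DifferentiableAt ℝ (fun y => (A y).det) x := by
  simp only [Matrix.det_apply']
  exact DifferentiableAt.fun_sum fun σ _ =>
    (HasFDerivAt.finsetProd fun i _ =>
      (hA (σ i) i).hasFDerivAt).differentiableAt.const_mul _

theorem differentiableAt_matrix_adjugate_apply {E n : Type*} [NormedAddCommGroup E]
    [NormedSpace ℝ E] [Fintype n] [DecidableEq n] {A : E → Matrix n n ℝ} {x : E}
    (hA : ∀ i j, DifferentiableAt ℝ (fun y => A y i j) x) (i j : n) :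
    DifferentiableAt ℝ (fun y => (A y).adjugate i j) x := by
  simp only [Matrix.adjugate_apply]
  refine differentiableAt_matrix_det fun a b => ?_
  by_cases h : a = j
  · subst h
    simp
  · simpa [Matrix.updateRow_ne h] using hA a b

theorem differentiableAt_matrix_inv_apply {E n : Type*} [NormedAddCommGroup E]
    [NormedSpace ℝ E] [Fintype n] [DecidableEq n] {A : E → Matrix n n ℝ} {x : E}
    (hA : ∀ i j, DifferentiableAt ℝ (fun y => A y i j) x) (hx : IsUnit (A x).det) (i j : n) :
    DifferentiableAt ℝ (fun y => (A y)⁻¹ i j) x := by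
  simp only [Matrix.inv_def, Ring.inverse_eq_inv', Matrix.smul_apply, smul_eq_mul]
  exact ((differentiableAt_matrix_det hA).fun_inv hx.ne_zero).mul
    (differentiableAt_matrix_adjugate_apply hA i j)

theorem pd_two_smul_sub {m : ℕ} {A B : (Fin m → ℝ) → Matrix (Fin m) (Fin m) ℝ} {x : Fin m → ℝ}
    (hA : ∀ i j, DifferentiableAt ℝ (fun y => A y i j) x)
    (hB : ∀ i j, DifferentiableAt ℝ (fun y => B y i j) x) (k : Fin m) :
    pd k (fun y => (2 : ℝ) • A y - B y) x = (2 : ℝ) • pd k A x - pd k B x := by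
  ext i j
  have h := (((hA i j).hasFDerivAt.const_mul (2 : ℝ)).fun_sub (hB i j).hasFDerivAt).fderiv
  simp only [pd, Matrix.of_apply, Matrix.sub_apply, Matrix.smul_apply, smul_eq_mul]
  rw [h]
  simp

/-- for a connection `Γ` with difference tensor `K = Γ − Γ^g` from the
Levi-Civita connection, `G·K_k` symmetric, and conjugate connection `Γ̄ = Γ^g − K`, one has
`(1/2)(R_{kl} + R̄_{kl}) = R^g_{kl} + K_k K_l − K_l K_k`. -/
theorem stmt_7 (m : ℕ) (U : Set (Fin m → ℝ)) (hUopen : IsOpen U)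
    (G : (Fin m → ℝ) → Matrix (Fin m) (Fin m) ℝ)
    (hG2 : ∀ i j, ContDiffOn ℝ 2 (fun x => G x i j) U)
    (hGsymm : ∀ x ∈ U, (G x)ᵀ = G x)
    (hGinv : ∀ x ∈ U, IsUnit (G x).det)
    (Γg : (Fin m → ℝ) → Fin m → Matrix (Fin m) (Fin m) ℝ)
    (hΓg : ∀ (x : Fin m → ℝ) (k i j : Fin m), Γg x k i j = (1 / 2 : ℝ) * ∑ s,
      (G x)⁻¹ i s * (fderiv ℝ (fun y => G y s j) x (Pi.single k 1)
        + fderiv ℝ (fun y => G y s k) x (Pi.single j 1)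
        - fderiv ℝ (fun y => G y k j) x (Pi.single s 1)))
    (Γ : (Fin m → ℝ) → Fin m → Matrix (Fin m) (Fin m) ℝ)
    (hΓ1 : ∀ k i j, ContDiffOn ℝ 1 (fun x => Γ x k i j) U)
    (K : (Fin m → ℝ) → Fin m → Matrix (Fin m) (Fin m) ℝ)
    (hK : ∀ x k, K x k = Γ x k - Γg x k)
    (hKsymm : ∀ x ∈ U, ∀ k, (G x * K x k)ᵀ = G x * K x k)
    (Γb : (Fin m → ℝ) → Fin m → Matrix (Fin m) (Fin m) ℝ)
    (hΓb : ∀ x k, Γb x k = Γg x k - K x k)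
    (R Rb Rg : (Fin m → ℝ) → Fin m → Fin m → Matrix (Fin m) (Fin m) ℝ)
    (hR : ∀ x k l, R x k l =
      pd k (fun y => Γ y l) x - pd l (fun y => Γ y k) x + Γ x k * Γ x l - Γ x l * Γ x k)
    (hRb : ∀ x k l, Rb x k l =
      pd k (fun y => Γb y l) x - pd l (fun y => Γb y k) x + Γb x k * Γb x l - Γb x l * Γb x k)
    (hRg : ∀ x k l, Rg x k l =
      pd k (fun y => Γg y l) x - pd l (fun y => Γg y k) x + Γg x k * Γg x l - Γg x l * Γg x k)
    (x : Fin m → ℝ) (hx : x ∈ U) (k l : Fin m) :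
    (1 / 2 : ℝ) • (R x k l + Rb x k l) = Rg x k l + (K x k * K x l - K x l * K x k) := by
  have hG : ∀ i j, ContDiffAt ℝ 2 (fun y => G y i j) x := fun i j =>
    (hG2 i j).contDiffAt (hUopen.mem_nhds hx)
  have hGd : ∀ i j, DifferentiableAt ℝ (fun y => G y i j) x := fun i j =>
    (hG i j).differentiableAt (by norm_num)
  have hGdd : ∀ i j v, DifferentiableAt ℝ (fun y => fderiv ℝ (fun z => G z i j) y v) x :=
    fun i j v => (((hG i j).fderiv_right (m := 1) (by norm_num)).differentiableAt
      (by norm_num)).clm_apply (differentiableAt_const v)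
  have hΓgd : ∀ k i j, DifferentiableAt ℝ (fun y => Γg y k i j) x := by
    intro k i j
    simp only [hΓg]
    exact (DifferentiableAt.fun_sum fun s _ =>
      (differentiableAt_matrix_inv_apply hGd (hGinv x hx) i s).fun_mul
        (((hGdd _ _ _).fun_add (hGdd _ _ _)).fun_sub (hGdd _ _ _))).const_mul _
  have hΓd : ∀ k i j, DifferentiableAt ℝ (fun y => Γ y k i j) x := fun k i j =>
    ((hΓ1 k i j).contDiffAt (hUopen.mem_nhds hx)).differentiableAt (by norm_num)
  have hΓb' : ∀ y k, Γb y k = (2 : ℝ) • Γg y k - Γ y k := by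
    intro y k
    rw [hΓb, hK, two_smul]
    abel
  have hpd : ∀ k l, pd k (fun y => Γb y l) x
      = (2 : ℝ) • pd k (fun y => Γg y l) x - pd k (fun y => Γ y l) x := by
    intro k l
    simp only [hΓb']
    exact pd_two_smul_sub (hΓgd l) (hΓd l) k
  have hΓK : ∀ k, Γ x k = Γg x k + K x k := by
    intro k
    rw [hK]
    abel
  rw [hR, hRb, hRg, hpd, hpd, hΓb, hΓb, hΓK, hΓK]
  simp only [mul_add, add_mul, mul_sub, sub_mul]
  module
end

section
/- Let U ⊆ ℝ^m be open, G : U → Matrix (Fin m) (Fin m) ℝ C², with G(x) symmetric and invertible for every x. Let Γ : U → Fin m → Matrix (Fin m) (Fin m) ℝ be C¹ and torsion-free, i.e. (Γ_k)ⁱⱼ = (Γ_j)ⁱₖ for all i, j, k at every point, and let Γ̄ be defined by the duality relation ∂_k G = (Γ_k)ᵀ·G + G·Γ̄_k. Define curvature matrices R_{kl} = ∂_kΓ_l − ∂_lΓ_k + Γ_kΓ_l − Γ_lΓ_k and R̄_{kl} analogously from Γ̄, and assume conjugate symmetry: R_{kl} = R̄_{kl} at every point for all k, l. Then the lowered curvature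 tensor R_{ijkl} := Σ_s G_{is}(R_{kl})ˢⱼ satisfies the pair-interchange symmetry R_{ijkl} = R_{klij} at every point of U. -/
open Matrix

section PartialDerivative

variable {m : ℕ} {F H : (Fin m → ℝ) → Matrix (Fin m) (Fin m) ℝ} {x : Fin m → ℝ}

theorem pd_congr (k : Fin m) (h : F =ᶠ[nhds x] H) : pd k F x = pd k H x := by
  ext i j
  have h' : (fun y => F y i j) =ᶠ[nhds x] fun y => H y i j := by
    filter_upwards [h] with y hy
    rw [hy]
  simp only [pd, Matrix.of_apply, h'.fderiv_eq]

theorem pd_transpose (k : Fin m) : pd k (fun y => (F y)ᵀ) x = (pd k F x)ᵀ := rfl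

theorem pd_add (k : Fin m) (hF : ∀ i j, DifferentiableAt ℝ (fun y => F y i j) x)
    (hH : ∀ i j, DifferentiableAt ℝ (fun y => H y i j) x) :
    pd k (fun y => F y + H y) x = pd k F x + pd k H x := by
  ext i j
  simp only [pd, Matrix.of_apply, Matrix.add_apply]
  rw [fderiv_fun_add (hF i j) (hH i j), _root_.add_apply]

theorem differentiableAt_mul_entry (hF : ∀ i j, DifferentiableAt ℝ (fun y => F y i j) x)
    (hH : ∀ i j, DifferentiableAt ℝ (fun y => H y i j) x) (i j : Fin m) :
    DifferentiableAt ℝ (fun y => (F y * H y) i j) x := by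
  simp only [Matrix.mul_apply]
  exact DifferentiableAt.fun_sum fun s _ => (hF i s).mul (hH s j)

theorem pd_mul (k : Fin m) (hF : ∀ i j, DifferentiableAt ℝ (fun y => F y i j) x)
    (hH : ∀ i j, DifferentiableAt ℝ (fun y => H y i j) x) :
    pd k (fun y => F y * H y) x = pd k F x * H x + F x * pd k H x := by
  ext i j
  simp only [pd, Matrix.of_apply, Matrix.add_apply, Matrix.mul_apply]
  rw [fderiv_fun_sum fun s _ => (hF i s).fun_mul (hH s j), _root_.sum_apply,
    ← Finset.sum_add_distrib]
  refine Finset.sum_congr rfl fun s _ => ?_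
  rw [fderiv_fun_mul (hF i s) (hH s j)]
  simp only [_root_.add_apply, _root_.smul_apply, smul_eq_mul]
  ring

theorem pd_comm (k l : Fin m) (hF : ∀ i j, ContDiffAt ℝ 2 (fun y => F y i j) x) :
    pd k (pd l F) x = pd l (pd k F) x := by
  ext i j
  have hd : DifferentiableAt ℝ (fderiv ℝ fun y => F y i j) x :=
    ((hF i j).fderiv_right (m := 1) (by norm_num)).differentiableAt (by norm_num)
  have hsymm := (hF i j).isSymmSndFDerivAt (by simp)
  simp only [pd, Matrix.of_apply]
  rw [fderiv_clm_apply hd (differentiableAt_const _),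
    fderiv_clm_apply hd (differentiableAt_const _)]
  simpa using hsymm.eq (Pi.single k 1) (Pi.single l 1)

/-- The curvatures of two connections that are dual with respect to `G` are negative adjoints of
each other with respect to `G`. -/
theorem curvature_dual {U : Set (Fin m → ℝ)} (hU : IsOpen U)
    {G : (Fin m → ℝ) → Matrix (Fin m) (Fin m) ℝ}
    (hG : ∀ i j, ContDiffOn ℝ 2 (fun x => G x i j) U)
    {Γ Γb : (Fin m → ℝ) → Fin m → Matrix (Fin m) (Fin m) ℝ}
    (hΓ : ∀ k i j, ContDiffOn ℝ 1 (fun x => Γ x k i j) U)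
    (hΓb : ∀ k i j, ContDiffOn ℝ 1 (fun x => Γb x k i j) U)
    (hdual : ∀ x ∈ U, ∀ k, pd k G x = (Γ x k)ᵀ * G x + G x * Γb x k)
    (hx : x ∈ U) (k l : Fin m) :
    (pd k (fun y => Γ y l) x - pd l (fun y => Γ y k) x + Γ x k * Γ x l - Γ x l * Γ x k)ᵀ * G x +
      G x * (pd k (fun y => Γb y l) x - pd l (fun y => Γb y k) x +
        Γb x k * Γb x l - Γb x l * Γb x k) = 0 := by
  have hUx : U ∈ nhds x := hU.mem_nhds hx
  have dG : ∀ i j, DifferentiableAt ℝ (fun y => G y i j) x := fun i j =>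
    ((hG i j).contDiffAt hUx).differentiableAt (by norm_num)
  have dΓ : ∀ k i j, DifferentiableAt ℝ (fun y => Γ y k i j) x := fun k i j =>
    ((hΓ k i j).contDiffAt hUx).differentiableAt (by norm_num)
  have dΓb : ∀ k i j, DifferentiableAt ℝ (fun y => Γb y k i j) x := fun k i j =>
    ((hΓb k i j).contDiffAt hUx).differentiableAt (by norm_num)
  have second : ∀ k l, pd k (pd l G) x =
      (pd k (fun y => Γ y l) x)ᵀ * G x + (Γ x l)ᵀ * ((Γ x k)ᵀ * G x + G x * Γb x k) +
      (((Γ x k)ᵀ * G x + G x * Γb x k) * Γb x l + G x * pd k (fun y => Γb y l) x) := by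
    intro k l
    have heq : pd l G =ᶠ[nhds x] fun y => (Γ y l)ᵀ * G y + G y * Γb y l := by
      filter_upwards [hUx] with y hy using hdual y hy l
    have dT : ∀ i j, DifferentiableAt ℝ (fun y => (Γ y l)ᵀ i j) x := fun i j => dΓ l j i
    rw [pd_congr k heq, pd_add k (differentiableAt_mul_entry dT dG)
      (differentiableAt_mul_entry dG (dΓb l)), pd_mul k dT dG, pd_mul k dG (dΓb l),
      pd_transpose, hdual x hx k]
  have hcomm := pd_comm k l fun i j => (hG i j).contDiffAt hUx
  rw [second k l, second l k, ← sub_eq_zero] at hcomm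
  rw [← hcomm]
  simp only [Matrix.transpose_add, Matrix.transpose_sub, Matrix.transpose_mul]
  noncomm_ring

/-- The first Bianchi identity for a torsion-free connection. -/
theorem bianchi_of_torsionFree {U : Set (Fin m → ℝ)} (hU : IsOpen U)
    {Γ : (Fin m → ℝ) → Fin m → Matrix (Fin m) (Fin m) ℝ}
    (htf : ∀ x ∈ U, ∀ i j k : Fin m, Γ x k i j = Γ x j i k)
    {R : Fin m → Fin m → Matrix (Fin m) (Fin m) ℝ}
    (hR : ∀ k l, R k l =
      pd k (fun y => Γ y l) x - pd l (fun y => Γ y k) x + Γ x k * Γ x l - Γ x l * Γ x k)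
    (hx : x ∈ U) (s j k l : Fin m) :
    R k l s j + R l j s k + R j k s l = 0 := by
  have hpd : ∀ a b c, pd a (fun y => Γ y b) x s c = pd a (fun y => Γ y c) x s b := by
    intro a b c
    have heq : (fun y => Γ y b s c) =ᶠ[nhds x] fun y => Γ y c s b := by
      filter_upwards [hU.mem_nhds hx] with y hy using htf y hy s c b
    simp only [pd, Matrix.of_apply, heq.fderiv_eq]
  have hmul : ∀ a b c, (Γ x a * Γ x b) s c = (Γ x a * Γ x c) s b := by
    intro a b c
    simp only [Matrix.mul_apply]
    exact Finset.sum_congr rfl fun t _ => by rw [htf x hx t c b]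
  simp only [hR, Matrix.sub_apply, Matrix.add_apply]
  linarith [hpd k l j, hpd l k j, hpd j k l, hmul k l j, hmul l k j, hmul j k l]

end PartialDerivative

/-- A four-index tensor that is skew in each pair of indices and satisfies the first Bianchi
identity is symmetric under interchange of the pairs. -/
theorem pair_symm_of_skew_of_bianchi {ι : Type*} {T : ι → ι → ι → ι → ℝ}
    (hskew : ∀ i j k l, T i j k l = -T j i k l) (hskew' : ∀ i j k l, T i j k l = -T i j l k)
    (hcyc : ∀ i j k l, T i j k l + T i k l j + T i l j k = 0) (i j k l : ι) :
    T i j k l = T k l i j := by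
  linarith [hcyc i j k l, hcyc j k l i, hcyc k l i j, hcyc l i j k, hskew i j k l,
    hskew i k l j, hskew i l j k, hskew j k l i, hskew j l i k, hskew k l i j,
    hskew' k i j l, hskew' l j k i]

/-- for a torsion-free connection `Γ` that is conjugate symmetric
(`R = R̄` for the conjugate connection `Γ̄` w.r.t. `G`), the lowered curvature tensor
`R_{ijkl} = ∑_s G_{is}(R_{kl})ˢⱼ` has the pair-interchange symmetry `R_{ijkl} = R_{klij}`. -/
theorem stmt_8 (m : ℕ) (U : Set (Fin m → ℝ)) (hUopen : IsOpen U)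
    (G : (Fin m → ℝ) → Matrix (Fin m) (Fin m) ℝ)
    (hG2 : ∀ i j, ContDiffOn ℝ 2 (fun x => G x i j) U)
    (hGsymm : ∀ x ∈ U, (G x)ᵀ = G x)
    (hGinv : ∀ x ∈ U, IsUnit (G x).det)
    (Γ Γb : (Fin m → ℝ) → Fin m → Matrix (Fin m) (Fin m) ℝ)
    (hΓ1 : ∀ k i j, ContDiffOn ℝ 1 (fun x => Γ x k i j) U)
    (hΓb1 : ∀ k i j, ContDiffOn ℝ 1 (fun x => Γb x k i j) U)
    (htf : ∀ x ∈ U, ∀ i j k : Fin m, Γ x k i j = Γ x j i k)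
    (hdual : ∀ x ∈ U, ∀ k, pd k G x = (Γ x k)ᵀ * G x + G x * Γb x k)
    (R Rb : (Fin m → ℝ) → Fin m → Fin m → Matrix (Fin m) (Fin m) ℝ)
    (hR : ∀ x k l, R x k l =
      pd k (fun y => Γ y l) x - pd l (fun y => Γ y k) x + Γ x k * Γ x l - Γ x l * Γ x k)
    (hRb : ∀ x k l, Rb x k l =
      pd k (fun y => Γb y l) x - pd l (fun y => Γb y k) x + Γb x k * Γb x l - Γb x l * Γb x k)
    (hconjsymm : ∀ x ∈ U, ∀ k l, R x k l = Rb x k l)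
    (x : Fin m → ℝ) (hx : x ∈ U) (i j k l : Fin m) :
    ∑ s, G x i s * R x k l s j = ∑ s, G x k s * R x i j s l := by
  have hskew : ∀ i j k l, (G x * R x k l) i j = -(G x * R x k l) j i := by
    intro i j k l
    have h := curvature_dual hUopen hG2 hΓ1 hΓb1 hdual hx k l
    rw [← hR, ← hRb, ← hconjsymm x hx] at h
    have h' : (G x * R x k l)ᵀ + G x * R x k l = 0 := by
      rw [Matrix.transpose_mul, hGsymm x hx, h]
    have hij := congrFun (congrFun h' i) j
    simp only [Matrix.add_apply, Matrix.transpose_apply, Matrix.zero_apply] at hij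
    linarith
  have hskew' : ∀ i j k l, (G x * R x k l) i j = -(G x * R x l k) i j := by
    intro i j k l
    have h : R x k l = -R x l k := by
      rw [hR, hR]
      abel
    rw [h, Matrix.mul_neg, Matrix.neg_apply]
  have hcyc : ∀ i j k l,
      (G x * R x k l) i j + (G x * R x l j) i k + (G x * R x j k) i l = 0 := by
    intro i j k l
    simp only [Matrix.mul_apply, ← Finset.sum_add_distrib, ← mul_add]
    exact Finset.sum_eq_zero fun s _ => by
      rw [bianchi_of_torsionFree hUopen htf (hR x) hx s j k l, mul_zero]
  simpa only [Matrix.mul_apply] using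
    pair_symm_of_skew_of_bianchi (T := fun i j k l => (G x * R x k l) i j) hskew hskew' hcyc i j k l
end

section
/- Define f : ℝ² → ℝ by f(x,y) = sinh x + cosh y. Then (1) for all (x,y) ∈ ℝ²: ∂⁴f/∂x⁴ + 2 ∂⁴f/∂x²∂y² + ∂⁴f/∂y⁴ − ( ∂²f/∂x² + 2 ∂²f/∂x∂y + ∂²f/∂y² ) = 0, i.e. ((∂_x² + ∂_y²)² − (∂_x + ∂_y)²) f = 0; and (2) there exists (x,y) ∈ ℝ² where ∂²f/∂x² + ∂²f/∂y² − ∂f/∂x − ∂f/∂y ≠ 0. -/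
/-- Partial derivative in the `x`-direction of a function on `ℝ²`. -/
noncomputable def px (f : ℝ × ℝ → ℝ) : ℝ × ℝ → ℝ := fun p => fderiv ℝ f p (1, 0)

/-- Partial derivative in the `y`-direction of a function on `ℝ²`. -/
noncomputable def py (f : ℝ × ℝ → ℝ) : ℝ × ℝ → ℝ := fun p => fderiv ℝ f p (0, 1)

theorem px_add_separated {g h : ℝ → ℝ} (hg : Differentiable ℝ g) (hh : Differentiable ℝ h) :
    px (fun p => g p.1 + h p.2) = fun p => deriv g p.1 := by
  funext p
  have h₁ := (hg p.1).hasDerivAt.comp_hasFDerivAt p (hasFDerivAt_fst (𝕜 := ℝ) (p := p))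
  have h₂ := (hh p.2).hasDerivAt.comp_hasFDerivAt p (hasFDerivAt_snd (𝕜 := ℝ) (p := p))
  have h₃ : fderiv ℝ (fun p : ℝ × ℝ => g p.1 + h p.2) p = _ := (h₁.add h₂).fderiv
  simp [px, h₃]

theorem py_add_separated {g h : ℝ → ℝ} (hg : Differentiable ℝ g) (hh : Differentiable ℝ h) :
    py (fun p => g p.1 + h p.2) = fun p => deriv h p.2 := by
  funext p
  have h₁ := (hg p.1).hasDerivAt.comp_hasFDerivAt p (hasFDerivAt_fst (𝕜 := ℝ) (p := p))
  have h₂ := (hh p.2).hasDerivAt.comp_hasFDerivAt p (hasFDerivAt_snd (𝕜 := ℝ) (p := p))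
  have h₃ : fderiv ℝ (fun p : ℝ × ℝ => g p.1 + h p.2) p = _ := (h₁.add h₂).fderiv
  simp [py, h₃]

theorem px_comp_fst {g : ℝ → ℝ} (hg : Differentiable ℝ g) :
    px (fun p => g p.1) = fun p => deriv g p.1 := by
  simpa using px_add_separated hg (differentiable_const (0 : ℝ))

theorem px_comp_snd {h : ℝ → ℝ} (hh : Differentiable ℝ h) :
    px (fun p => h p.2) = fun _ => 0 := by
  simpa using px_add_separated (differentiable_const (0 : ℝ)) hh

theorem py_comp_snd {h : ℝ → ℝ} (hh : Differentiable ℝ h) :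
    py (fun p => h p.2) = fun p => deriv h p.2 := by
  simpa using py_add_separated (differentiable_const (0 : ℝ)) hh

theorem px_const (c : ℝ) : px (fun _ => c) = fun _ => 0 := by
  funext p
  simp [px]

/-- `f(x,y) = sinh x + cosh y` satisfies
`((∂_x² + ∂_y²)² − (∂_x + ∂_y)²) f = 0` everywhere, while
`(∂_x² + ∂_y²)f − (∂_x + ∂_y)f` does not vanish identically. -/
theorem stmt_9 (f : ℝ × ℝ → ℝ)
    (hf : ∀ x y : ℝ, f (x, y) = Real.sinh x + Real.cosh y) :
    (∀ p : ℝ × ℝ,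
      px (px (px (px f))) p + 2 * px (px (py (py f))) p + py (py (py (py f))) p
        - (px (px f) p + 2 * px (py f) p + py (py f) p) = 0) ∧
    (∃ p : ℝ × ℝ, px (px f) p + py (py f) p - px f p - py f p ≠ 0) := by
  obtain rfl : f = fun p => Real.sinh p.1 + Real.cosh p.2 := funext fun p => hf p.1 p.2
  have hs := Real.differentiable_sinh
  have hc := Real.differentiable_cosh
  simp only [px_add_separated hs hc, py_add_separated hs hc, px_comp_fst hs, px_comp_fst hc,
    px_comp_snd hs, px_comp_snd hc, px_const, py_comp_snd hs, py_comp_snd hc, Real.deriv_sinh,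
    Real.deriv_cosh]
  refine ⟨fun p => by ring, (1, 0), ?_⟩
  have h_exp : Real.exp (-1) < 1 := by simp
  have h_sub := Real.cosh_sub_sinh 1
  simp only [Real.cosh_zero, Real.sinh_zero]
  intro h
  linarith
end

section
/- For a twice continuously differentiable curve c = (c₁, c₂) : ℝ → ℝ², define for i ∈ {1,2}: τᵢ = cᵢ'' + (cᵢ')², Wᵢ = τᵢ' − cᵢ'·τᵢ, and (τ₂)ᵢ = Wᵢ' − cᵢ'·Wᵢ − τᵢ². Then for any real numbers a, b, p, q, the line c(t) = (a t + p, b t + q) satisfies (τ₂)₁(t) = 0 and (τ₂)₂(t) = 0 for all t ∈ ℝ, while τ₁(t) = a² and τ₂-component τ₂(t) = b² for all t; in particular if a ≠ 0 or b ≠ 0 then the tension field (τ₁, τ₂) is nowhere (a ≠ 0 case) not identically zero. -/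
/-- The tension component along an affine curve of slope `a` is `a ^ 2`, and the bi-tension
component vanishes. -/
theorem tension_bitension_affine {a p : ℝ} {c tau W bt : ℝ → ℝ}
    (hc : ∀ t, c t = a * t + p)
    (htau : ∀ t, tau t = deriv (deriv c) t + (deriv c t) ^ 2)
    (hW : ∀ t, W t = deriv tau t - deriv c t * tau t)
    (hbt : ∀ t, bt t = deriv W t - deriv c t * W t - (tau t) ^ 2) (t : ℝ) :
    tau t = a ^ 2 ∧ bt t = 0 := by
  have hdc : deriv c = fun _ => a := by
    funext s
    rw [funext hc]
    simp
  have htau' : tau = fun _ => a ^ 2 := by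
    funext s
    simp [htau, hdc]
  have hW' : W = fun _ => -a ^ 3 := by
    funext s
    simp only [hW, hdc, htau', deriv_const]
    ring
  refine ⟨by rw [htau'], ?_⟩
  simp only [hbt, hdc, htau', hW', deriv_const]
  ring

/-- on the statistical manifold `(ℝ², g₀, ∇)` with `Γˣ_{xx} = Γʸ_{yy} = 1`,
the line `c(t) = (at+p, bt+q)` has vanishing statistical bi-tension field, while its tension
field has components `(a², b²)`; in particular it is not identically zero if `a ≠ 0` or
`b ≠ 0`. -/
theorem stmt_10 (a b p q : ℝ) (c₁ c₂ : ℝ → ℝ)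
    (hc₁ : ∀ t, c₁ t = a * t + p) (hc₂ : ∀ t, c₂ t = b * t + q)
    (hc₁' : ContDiff ℝ 2 c₁) (hc₂' : ContDiff ℝ 2 c₂)
    (tau₁ tau₂ W₁ W₂ bt₁ bt₂ : ℝ → ℝ)
    (htau₁ : ∀ t, tau₁ t = deriv (deriv c₁) t + (deriv c₁ t) ^ 2)
    (htau₂ : ∀ t, tau₂ t = deriv (deriv c₂) t + (deriv c₂ t) ^ 2)
    (hW₁ : ∀ t, W₁ t = deriv tau₁ t - deriv c₁ t * tau₁ t)
    (hW₂ : ∀ t, W₂ t = deriv tau₂ t - deriv c₂ t * tau₂ t)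
    (hbt₁ : ∀ t, bt₁ t = deriv W₁ t - deriv c₁ t * W₁ t - (tau₁ t) ^ 2)
    (hbt₂ : ∀ t, bt₂ t = deriv W₂ t - deriv c₂ t * W₂ t - (tau₂ t) ^ 2) :
    (∀ t : ℝ, bt₁ t = 0 ∧ bt₂ t = 0) ∧
    (∀ t : ℝ, tau₁ t = a ^ 2 ∧ tau₂ t = b ^ 2) ∧
    ((a ≠ 0 ∨ b ≠ 0) → ¬ (∀ t : ℝ, tau₁ t = 0 ∧ tau₂ t = 0)) := by
  have h₁ := tension_bitension_affine hc₁ htau₁ hW₁ hbt₁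
  have h₂ := tension_bitension_affine hc₂ htau₂ hW₂ hbt₂
  refine ⟨fun t => ⟨(h₁ t).2, (h₂ t).2⟩, fun t => ⟨(h₁ t).1, (h₂ t).1⟩, ?_⟩
  rintro (ha | hb) h
  · exact pow_ne_zero 2 ha ((h₁ 0).1.symm.trans (h 0).1)
  · exact pow_ne_zero 2 hb ((h₂ 0).1.symm.trans (h 0).2)
end

section
/- Let m ≥ 1. Let f : ℝ^m → ℝ and V : ℝ^m → ℝ^m be smooth and ℤ^m-periodic (f(x + eᵢ) = f(x) and V(x + eᵢ) = V(x) for all x and all standard basis vectors eᵢ). Assume Σᵢ ∂ᵢVᵢ(x) = 0 for all x. If the function x ↦ Δ₀f(x) − ⟪V(x), ∇f(x)⟫ is constant on ℝ^m, where Δ₀f = Σᵢ ∂ᵢ²f and ∇f is the Euclidean gradient, then f is constant. -/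
open MeasureTheory Set

/-- The divergence of a periodic `C¹` vector field integrates to zero over every unit cube. -/
theorem integral_divergence_eq_zero_of_periodic {m : ℕ} (W : Fin m → (Fin m → ℝ) → ℝ)
    (hW : ∀ i, ContDiff ℝ 1 (W i))
    (hper : ∀ i x, W i (x + Pi.single i 1) = W i x) (a : Fin m → ℝ) :
    ∫ x in Icc a (a + 1), ∑ i, fderiv ℝ (W i) x (Pi.single i 1) = 0 := by
  cases m with
  | zero => simp
  | succ n =>
    have hcont : Continuous fun x => ∑ i, fderiv ℝ (W i) x (Pi.single i 1) :=
      continuous_finsetSum _ fun i _ =>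
        ((hW i).continuous_fderiv one_ne_zero).clm_apply continuous_const
    rw [integral_divergence_of_hasFDerivAt_off_countable' a (a + 1) (by simp) W
      (fun i => fderiv ℝ (W i)) ∅ countable_empty (fun i => (hW i).continuous.continuousOn)
      (fun x _ i => ((hW i).differentiable one_ne_zero x).hasFDerivAt)
      (hcont.continuousOn.integrableOn_compact isCompact_Icc)]
    refine Finset.sum_eq_zero fun i _ => sub_eq_zero.2 (integral_congr_ae (.of_forall fun x => ?_))
    have key : i.insertNth ((a + 1) i) x = i.insertNth (a i) x + (Pi.single i 1 : Fin (n + 1) → ℝ) := by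
      ext j
      rcases Fin.eq_self_or_eq_succAbove i j with rfl | ⟨k, rfl⟩ <;> simp
    simp only [key, hper]

/-- A nonnegative continuous function whose integral over a unit cube vanishes is zero at the
corner of the cube. -/
theorem eq_zero_of_integral_unitCube_eq_zero {m : ℕ} {g : (Fin m → ℝ) → ℝ} (hg : Continuous g)
    (hnonneg : ∀ x, 0 ≤ g x) (a : Fin m → ℝ) (h : ∫ x in Icc a (a + 1), g x = 0) : g a = 0 := by
  have hae := (setIntegral_eq_zero_iff_of_nonneg_ae (.of_forall hnonneg)
    (hg.continuousOn.integrableOn_compact isCompact_Icc)).1 h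
  refine Measure.eqOn_of_ae_eq hae hg.continuousOn continuousOn_const ?_ (by simp : a ∈ _)
  rw [← pi_univ_Icc, interior_pi_set finite_univ, closure_pi_set]
  exact pi_mono fun i _ => (closure_interior_Icc (by simp)).ge

/-- on the flat torus (ℤ^m-periodic data on ℝ^m) with a divergence-free
vector field `V` (so that `div^g(tr_g K) = 0`), if the statistical Laplacian
`Δf = Δ₀f − ⟪V, ∇f⟫` is constant, then `f` is constant. -/
theorem stmt_11 (m : ℕ) (hm : 1 ≤ m)
    (f : (Fin m → ℝ) → ℝ) (V : (Fin m → ℝ) → (Fin m → ℝ))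
    (hf : ContDiff ℝ (⊤ : ℕ∞) f) (hV : ContDiff ℝ (⊤ : ℕ∞) V)
    (hfper : ∀ (x : Fin m → ℝ) (i : Fin m), f (x + Pi.single i 1) = f x)
    (hVper : ∀ (x : Fin m → ℝ) (i : Fin m), V (x + Pi.single i 1) = V x)
    (hdiv : ∀ x, ∑ i, fderiv ℝ (fun y => V y i) x (Pi.single i 1) = 0)
    (c : ℝ)
    (hconst : ∀ x,
      (∑ i, fderiv ℝ (fun y => fderiv ℝ f y (Pi.single i 1)) x (Pi.single i 1))
        - ∑ i, V x i * fderiv ℝ f x (Pi.single i 1) = c) :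
    ∀ x y, f x = f y := by
  have hf1 : Differentiable ℝ f := hf.differentiable (by simp)
  have hD : ∀ i, ContDiff ℝ (⊤ : ℕ∞) fun y => fderiv ℝ f y (Pi.single i 1) := fun i =>
    (hf.fderiv_right (m := (⊤ : ℕ∞)) (by simp)).clm_apply contDiff_const
  have hD1 : ∀ i, Differentiable ℝ fun y => fderiv ℝ f y (Pi.single i 1) := fun i =>
    (hD i).differentiable (by simp)
  have hVi : ∀ i, ContDiff ℝ (⊤ : ℕ∞) fun y => V y i := contDiff_pi.1 hV
  have hVi1 : ∀ i, Differentiable ℝ fun y => V y i := fun i => (hVi i).differentiable (by simp)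
  have hDper : ∀ x i, fderiv ℝ f (x + Pi.single i 1) = fderiv ℝ f x := fun x i => by
    rw [← fderiv_comp_add_right]
    simp only [hfper]
  have hc : c = 0 := by
    have h := integral_divergence_eq_zero_of_periodic
      (fun i y => fderiv ℝ f y (Pi.single i 1) - f y * V y i)
      (fun i => ((hD i).sub (hf.mul (hVi i))).of_le (by simp))
      (fun i x => by simp only [hDper, hfper, hVper]) 0
    have hdivergence : ∀ x, ∑ i, fderiv ℝ (fun y => fderiv ℝ f y (Pi.single i 1) - f y * V y i) x
        (Pi.single i 1) = c := fun x => by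
      rw [← hconst x, ← sub_zero (_ - _), ← mul_zero (f x), ← hdiv x, Finset.mul_sum,
        ← Finset.sum_sub_distrib, ← Finset.sum_sub_distrib]
      refine Finset.sum_congr rfl fun i _ => ?_
      rw [fderiv_fun_sub (hD1 i x) ((hf1 x).fun_mul (hVi1 i x)), fderiv_fun_mul (hf1 x) (hVi1 i x)]
      simp
      ring
    simpa [hdivergence, measureReal_def, Real.volume_Icc_pi] using h
  have hgrad : ∀ x, ∑ i, fderiv ℝ f x (Pi.single i 1) ^ 2 = 0 := fun a => by
    have h := integral_divergence_eq_zero_of_periodic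
      (fun i y => f y * fderiv ℝ f y (Pi.single i 1) - 2⁻¹ * (f y * f y * V y i))
      (fun i => ((hf.mul (hD i)).sub
        (contDiff_const.mul ((hf.mul hf).mul (hVi i)))).of_le (by simp))
      (fun i x => by simp only [hDper, hfper, hVper]) a
    have hdivergence : ∀ x, ∑ i, fderiv ℝ
        (fun y => f y * fderiv ℝ f y (Pi.single i 1) - 2⁻¹ * (f y * f y * V y i)) x
        (Pi.single i 1) = ∑ i, fderiv ℝ f x (Pi.single i 1) ^ 2 := fun x => by
      have hx : ∑ i, fderiv ℝ f x (Pi.single i 1) ^ 2 =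
          ∑ i, fderiv ℝ f x (Pi.single i 1) ^ 2 + f x * (∑ i,
            fderiv ℝ (fun y => fderiv ℝ f y (Pi.single i 1)) x (Pi.single i 1)
            - ∑ i, V x i * fderiv ℝ f x (Pi.single i 1))
          - 2⁻¹ * (f x * f x) * ∑ i, fderiv ℝ (fun y => V y i) x (Pi.single i 1) := by
        rw [hconst, hdiv, hc]
        ring
      rw [hx, ← Finset.sum_sub_distrib, Finset.mul_sum, Finset.mul_sum, ← Finset.sum_add_distrib,
        ← Finset.sum_sub_distrib]
      refine Finset.sum_congr rfl fun i _ => ?_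
      rw [fderiv_fun_sub ((hf1 x).fun_mul (hD1 i x))
          ((((hf1 x).fun_mul (hf1 x)).fun_mul (hVi1 i x)).const_mul _),
        fderiv_fun_mul (hf1 x) (hD1 i x),
        fderiv_const_mul (((hf1 x).fun_mul (hf1 x)).fun_mul (hVi1 i x)),
        fderiv_fun_mul ((hf1 x).fun_mul (hf1 x)) (hVi1 i x), fderiv_fun_mul (hf1 x) (hf1 x)]
      simp
      ring
    simp only [hdivergence] at h
    exact eq_zero_of_integral_unitCube_eq_zero
      (continuous_finsetSum _ fun i _ => (hD i).continuous.pow 2)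
      (fun x => Finset.sum_nonneg fun i _ => sq_nonneg _) a h
  refine is_const_of_fderiv_eq_zero hf1 fun x => ?_
  have hzero := (Finset.sum_eq_zero_iff_of_nonneg fun i _ => sq_nonneg _).1 (hgrad x)
  refine ContinuousLinearMap.coe_injective ((Pi.basisFun ℝ (Fin m)).ext fun i => ?_)
  simpa using hzero i (Finset.mem_univ i)
end

section
/- Let m ≥ 1. Let f : ℝ^m → ℝ and V : ℝ^m → ℝ^m be smooth and ℤ^m-periodic, and assume Σᵢ ∂ᵢVᵢ(x) = 0 for all x. Define u : ℝ^m → ℝ by u = Δ₀f − ⟪V, ∇f⟫, where Δ₀f = Σᵢ ∂ᵢ²f and ∇f is the Euclidean gradient. If Δ₀u + ⟪V, ∇u⟫ = 0 on all of ℝ^m, then f is constant. -/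
open MeasureTheory Set

section PeriodicCalculus

variable {m : ℕ} {f g : (Fin m → ℝ) → ℝ}

/-- The partial derivative of `f` in the `i`-th coordinate direction. -/
noncomputable def partialDeriv (f : (Fin m → ℝ) → ℝ) (i : Fin m) : (Fin m → ℝ) → ℝ :=
  fun x => fderiv ℝ f x (Pi.single i 1)

lemma ContDiff.partialDeriv_infty (hf : ContDiff ℝ (⊤ : ℕ∞) f) (i : Fin m) :
    ContDiff ℝ (⊤ : ℕ∞) (partialDeriv f i) :=
  (hf.fderiv_right (by simp)).clm_apply contDiff_const

lemma partialDeriv_periodic (i : Fin m) {v : Fin m → ℝ} (hf : ∀ x, f (x + v) = f x)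
    (x : Fin m → ℝ) : partialDeriv f i (x + v) = partialDeriv f i x := by
  unfold partialDeriv
  rw [← fderiv_comp_add_right, funext hf]

lemma partialDeriv_add (hf : Differentiable ℝ f) (hg : Differentiable ℝ g) (i : Fin m)
    (x : Fin m → ℝ) :
    partialDeriv (fun y => f y + g y) i x = partialDeriv f i x + partialDeriv g i x := by
  simp [partialDeriv, fderiv_fun_add (hf x) (hg x)]

lemma partialDeriv_mul (hf : Differentiable ℝ f) (hg : Differentiable ℝ g) (i : Fin m)
    (x : Fin m → ℝ) :
    partialDeriv (fun y => f y * g y) i x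
      = f x * partialDeriv g i x + g x * partialDeriv f i x := by
  simp [partialDeriv, fderiv_fun_mul (hf x) (hg x)]

lemma partialDeriv_const_mul (c : ℝ) (hf : Differentiable ℝ f) (i : Fin m) (x : Fin m → ℝ) :
    partialDeriv (fun y => c * f y) i x = c * partialDeriv f i x := by
  simp [partialDeriv, fderiv_const_mul (hf x)]

lemma eq_of_partialDeriv_eq_zero (hf : Differentiable ℝ f)
    (h : ∀ i x, partialDeriv f i x = 0) (x y : Fin m → ℝ) : f x = f y := by
  refine is_const_of_fderiv_eq_zero (𝕜 := ℝ) hf (fun z => ?_) x y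
  refine ContinuousLinearMap.coe_injective (LinearMap.pi_ext' fun i => LinearMap.ext_ring ?_)
  simpa using! h i z

/-- The divergence of a periodic vector field integrates to zero over a unit cube. -/
lemma setIntegral_divergence_eq_zero_of_periodic {n : ℕ}
    {W : Fin (n + 1) → (Fin (n + 1) → ℝ) → ℝ} (hW : ∀ i, ContDiff ℝ (⊤ : ℕ∞) (W i))
    (hper : ∀ i x, W i (x + Pi.single i 1) = W i x) (a : Fin (n + 1) → ℝ) :
    ∫ x in Icc a (a + 1), ∑ i, partialDeriv (W i) i x = 0 := by
  have hcont : Continuous fun x => ∑ i, partialDeriv (W i) i x :=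
    continuous_finsetSum _ fun i _ => ((hW i).partialDeriv_infty i).continuous
  have key := integral_divergence_of_hasFDerivAt_off_countable' a (a + 1)
    (le_add_of_nonneg_right zero_le_one) W (fun i x => fderiv ℝ (W i) x) ∅ countable_empty
    (fun i => (hW i).continuous.continuousOn)
    (fun x _ i => ((hW i).differentiable (by simp) x).hasFDerivAt)
    (hcont.continuousOn.integrableOn_compact isCompact_Icc)
  refine key.trans (Finset.sum_eq_zero fun i _ => ?_)
  have hface : ∀ y : Fin n → ℝ,
      W i (i.insertNth ((a + 1) i) y) = W i (i.insertNth (a i) y) := fun y => by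
    rw [← hper i (i.insertNth (a i) y)]
    congr 1
    ext j
    refine Fin.succAboveCases i ?_ (fun k => ?_) j <;> simp
  simp only [hface]
  exact sub_eq_zero.2 rfl

/-- A nonnegative divergence of a periodic vector field vanishes identically. -/
lemma divergence_eq_zero_of_nonneg_of_periodic {W : Fin m → (Fin m → ℝ) → ℝ}
    (hW : ∀ i, ContDiff ℝ (⊤ : ℕ∞) (W i))
    (hper : ∀ i x, W i (x + Pi.single i 1) = W i x)
    (hnonneg : ∀ x, 0 ≤ ∑ i, partialDeriv (W i) i x) (x : Fin m → ℝ) :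
    ∑ i, partialDeriv (W i) i x = 0 := by
  obtain _ | n := m
  · simp
  have hcont : Continuous fun x => ∑ i, partialDeriv (W i) i x :=
    continuous_finsetSum _ fun i _ => ((hW i).partialDeriv_infty i).continuous
  set a : Fin (n + 1) → ℝ := fun i => x i - 1 / 2 with ha
  have hae := (setIntegral_eq_zero_iff_of_nonneg_ae (Filter.Eventually.of_forall hnonneg)
    (hcont.continuousOn.integrableOn_compact isCompact_Icc)).1
    (setIntegral_divergence_eq_zero_of_periodic hW hper a)
  refine Measure.eqOn_open_of_ae_eq (ae_restrict_of_ae_restrict_of_subset interior_subset hae)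
    isOpen_interior hcont.continuousOn continuousOn_const ?_
  rw [mem_interior_iff_mem_nhds]
  exact Filter.mem_of_superset
    (pi_Ioo_mem_nhds (fun i => by simp [ha]) (fun i => by simp only [ha, Pi.add_apply, Pi.one_apply]; linarith))
    Ioo_subset_Icc_self

/-- On the flat torus, solutions of `Δ₀g + ⟪V, ∇g⟫ = 0` with `V` divergence-free are constant. -/
lemma eq_of_laplacian_add_drift_eq_zero {V : Fin m → (Fin m → ℝ) → ℝ}
    (hg : ContDiff ℝ (⊤ : ℕ∞) g) (hV : ∀ i, ContDiff ℝ (⊤ : ℕ∞) (V i))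
    (hgper : ∀ x i, g (x + Pi.single i 1) = g x)
    (hVper : ∀ i x, V i (x + Pi.single i 1) = V i x)
    (hdiv : ∀ x, ∑ i, partialDeriv (V i) i x = 0)
    (h : ∀ x, ∑ i, partialDeriv (partialDeriv g i) i x + ∑ i, V i x * partialDeriv g i x = 0)
    (x y : Fin m → ℝ) : g x = g y := by
  have hd : ∀ {k : (Fin m → ℝ) → ℝ}, ContDiff ℝ (⊤ : ℕ∞) k → Differentiable ℝ k :=
    fun hk => hk.differentiable (by simp)
  have hW : ∀ i, ContDiff ℝ (⊤ : ℕ∞)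
      (fun y => g y * (partialDeriv g i y + 1 / 2 * (g y * V i y))) := fun i =>
    hg.mul ((hg.partialDeriv_infty i).add (contDiff_const.mul (hg.mul (hV i))))
  have hdivW : ∀ x, ∑ i,
      partialDeriv (fun y => g y * (partialDeriv g i y + 1 / 2 * (g y * V i y))) i x
        = ∑ i, partialDeriv g i x ^ 2 := fun x => by
    have hi : ∀ i,
        partialDeriv (fun y => g y * (partialDeriv g i y + 1 / 2 * (g y * V i y))) i x
          = partialDeriv g i x ^ 2
            + g x * (partialDeriv (partialDeriv g i) i x + V i x * partialDeriv g i x)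
            + g x ^ 2 / 2 * partialDeriv (V i) i x := fun i => by
      have hg' := hg.partialDeriv_infty i
      rw [partialDeriv_mul (hd hg) (hd (hg'.add (contDiff_const.mul (hg.mul (hV i))))),
        partialDeriv_add (hd hg') (hd (contDiff_const.mul (hg.mul (hV i)))),
        partialDeriv_const_mul _ (hd (hg.mul (hV i))), partialDeriv_mul (hd hg) (hd (hV i))]
      ring
    simp only [hi, Finset.sum_add_distrib, ← Finset.mul_sum, hdiv, h, mul_zero, add_zero]
  have hzero := divergence_eq_zero_of_nonneg_of_periodic hW
    (fun i x => by simp only [hgper, hVper, partialDeriv_periodic i (hgper · i)])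
    (fun x => by rw [hdivW]; positivity)
  refine eq_of_partialDeriv_eq_zero (hd hg) (fun i x => ?_) x y
  have hsum := (hdivW x).symm.trans (hzero x)
  exact pow_eq_zero_iff two_ne_zero |>.1
    ((Finset.sum_eq_zero_iff_of_nonneg fun i _ => sq_nonneg _).1 hsum i (Finset.mem_univ i))

end PeriodicCalculus


/-- on the flat torus with a divergence-free vector field `V`, a statistical
biharmonic function (`Δ̄Δf = 0` where `Δf = Δ₀f − ⟪V,∇f⟫` and `Δ̄u = Δ₀u + ⟪V,∇u⟫`)
is constant. -/
theorem stmt_12 (m : ℕ) (hm : 1 ≤ m)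
    (f : (Fin m → ℝ) → ℝ) (V : (Fin m → ℝ) → (Fin m → ℝ))
    (hf : ContDiff ℝ (⊤ : ℕ∞) f) (hV : ContDiff ℝ (⊤ : ℕ∞) V)
    (hfper : ∀ (x : Fin m → ℝ) (i : Fin m), f (x + Pi.single i 1) = f x)
    (hVper : ∀ (x : Fin m → ℝ) (i : Fin m), V (x + Pi.single i 1) = V x)
    (hdiv : ∀ x, ∑ i, fderiv ℝ (fun y => V y i) x (Pi.single i 1) = 0)
    (u : (Fin m → ℝ) → ℝ)
    (hu : ∀ x, u x =
      (∑ i, fderiv ℝ (fun y => fderiv ℝ f y (Pi.single i 1)) x (Pi.single i 1))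
        - ∑ i, V x i * fderiv ℝ f x (Pi.single i 1))
    (hbih : ∀ x,
      (∑ i, fderiv ℝ (fun y => fderiv ℝ u y (Pi.single i 1)) x (Pi.single i 1))
        + ∑ i, V x i * fderiv ℝ u x (Pi.single i 1) = 0) :
    ∀ x y, f x = f y := by
  have hd : ∀ {k : (Fin m → ℝ) → ℝ}, ContDiff ℝ (⊤ : ℕ∞) k → Differentiable ℝ k :=
    fun hk => hk.differentiable (by simp)
  have hVi : ∀ i, ContDiff ℝ (⊤ : ℕ∞) (fun y => V y i) := fun i => contDiff_pi.1 hV i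
  have hf' : ∀ i, ContDiff ℝ (⊤ : ℕ∞) (partialDeriv f i) := hf.partialDeriv_infty
  change ∀ x, ∑ i, partialDeriv (fun y => V y i) i x = 0 at hdiv
  change ∀ x, u x = ∑ i, partialDeriv (partialDeriv f i) i x
    - ∑ i, V x i * partialDeriv f i x at hu
  have hu_smooth : ContDiff ℝ (⊤ : ℕ∞) u := by
    rw [funext hu]
    exact (ContDiff.sum fun i _ => (hf' i).partialDeriv_infty i).sub
      (ContDiff.sum fun i _ => (hVi i).mul (hf' i))
  have hu_per : ∀ x i, u (x + Pi.single i 1) = u x := fun x i => by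
    have hper' : ∀ j y, partialDeriv f j (y + Pi.single i 1) = partialDeriv f j y :=
      fun j => partialDeriv_periodic j (hfper · i)
    simp only [hu, hVper, hper', fun j => partialDeriv_periodic j (hper' j)]
  have hu_const : ∀ x y, u x = u y :=
    eq_of_laplacian_add_drift_eq_zero (V := fun i y => V y i) hu_smooth hVi hu_per
      (fun i x => by rw [hVper]) hdiv hbih
  -- `u` is the divergence of `∇f - f V`, so the constant `u ^ 2` is a divergence as well.
  have hdivW : ∀ x, ∑ i,
      partialDeriv (fun y => u 0 * (partialDeriv f i y + -1 * (f y * V y i))) i x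
        = u 0 ^ 2 := fun x => by
    have hi : ∀ i,
        partialDeriv (fun y => u 0 * (partialDeriv f i y + -1 * (f y * V y i))) i x
          = u 0 * (partialDeriv (partialDeriv f i) i x - V x i * partialDeriv f i x)
            - u 0 * f x * partialDeriv (fun y => V y i) i x := fun i => by
      have hfV := hf.mul (hVi i)
      rw [partialDeriv_const_mul _ (hd ((hf' i).add (contDiff_const.mul hfV))),
        partialDeriv_add (hd (hf' i)) (hd (contDiff_const.mul hfV)),
        partialDeriv_const_mul _ (hd hfV), partialDeriv_mul (hd hf) (hd (hVi i))]
      ring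
    simp only [hi, Finset.sum_sub_distrib, ← Finset.mul_sum, hdiv, ← hu, hu_const x 0]
    ring
  have hu_zero : ∀ x, u x = 0 := fun x => by
    have hsq := divergence_eq_zero_of_nonneg_of_periodic
      (fun i => contDiff_const.mul
        ((hf' i).add (contDiff_const.mul (hf.mul (hVi i)))))
      (fun i x => by simp only [hfper, hVper, partialDeriv_periodic i (hfper · i)])
      (fun x => by rw [hdivW]; positivity) x
    rw [hdivW] at hsq
    rw [hu_const x 0]
    exact pow_eq_zero_iff two_ne_zero |>.1 hsq
  refine eq_of_laplacian_add_drift_eq_zero (V := fun i y => -V y i) hf (fun i => (hVi i).neg)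
    hfper (fun i x => by rw [hVper]) (fun x => ?_) (fun x => ?_)
  · have hneg : ∀ i, partialDeriv (fun y => -V y i) i x
        = -partialDeriv (fun y => V y i) i x := fun i => by simp [partialDeriv]
    simp only [hneg, Finset.sum_neg_distrib, hdiv, neg_zero]
  · simp only [neg_mul, Finset.sum_neg_distrib, ← sub_eq_add_neg, ← hu, hu_zero]
end
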